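/- arXiv:2403.03625 — 3 statements merged into one kernel-verified Lean document; each statement's English description precedes it below -/
import Mathlib

section
/- Let 4 ≤ h ≤ k−3 and let A = {a₁ < a₂ < ⋯ < a_k} be a set of k positive integers with A_{h+1} = {a₁,…,a_{h+1}}. If |h^∧_± A| = 2hk − h² + 1 and |h^∧_± A_{h+1}| ≥ (h+1)², then A = a₁·{1, 3, 5, …, 2k−1}. -/
open Finset

/-- The restricted `h`-fold signed sumset of a finite set `A` of integers:
all sums `∑ λᵢ aᵢ` with `λᵢ ∈ {-1,0,1}` and `∑ |λᵢ| = h`. -/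
def signedSumset (h : ℕ) (A : Finset ℤ) : Set ℤ :=
  {s | ∃ f : ℤ → ℤ, (∀ a, f a = -1 ∨ f a = 0 ∨ f a = 1) ∧ (∀ a ∉ A, f a = 0) ∧
    (∑ a ∈ A, |f a|) = (h : ℤ) ∧ s = ∑ a ∈ A, f a * a}

/-- The `h`-fold signed sums of `a 1, …, a n`, indexed by the set `P` of indices with sign `+`
and the set `N` of indices with sign `-`. -/
def indexSums (a : ℕ → ℤ) (h n : ℕ) : Finset ℤ :=
  (((Icc 1 n).powerset ×ˢ (Icc 1 n).powerset).filter
    fun p => Disjoint p.1 p.2 ∧ #p.1 + #p.2 = h).image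
    fun p => ∑ i ∈ p.1, a i - ∑ i ∈ p.2, a i

theorem mem_indexSums {a : ℕ → ℤ} {h n : ℕ} {s : ℤ} :
    s ∈ indexSums a h n ↔ ∃ P N : Finset ℕ, P ⊆ Icc 1 n ∧ N ⊆ Icc 1 n ∧ Disjoint P N ∧
      #P + #N = h ∧ ∑ i ∈ P, a i - ∑ i ∈ N, a i = s := by
  simp only [indexSums, mem_image, mem_filter, mem_product, mem_powerset, Prod.exists]
  constructor
  · rintro ⟨P, N, ⟨⟨hP, hN⟩, hd, hc⟩, hs⟩
    exact ⟨P, N, hP, hN, hd, hc, hs⟩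
  · rintro ⟨P, N, hP, hN, hd, hc, hs⟩
    exact ⟨P, N, ⟨⟨hP, hN⟩, hd, hc⟩, hs⟩

theorem indexSums_mono {a : ℕ → ℤ} {h m n : ℕ} (hmn : m ≤ n) :
    indexSums a h m ⊆ indexSums a h n := by
  intro s
  simp only [mem_indexSums]
  rintro ⟨P, N, hP, hN, hd⟩
  have := Icc_subset_Icc_right (a := 1) hmn
  exact ⟨P, N, hP.trans this, hN.trans this, hd⟩

theorem neg_mem_indexSums {a : ℕ → ℤ} {h n : ℕ} {s : ℤ} (hs : s ∈ indexSums a h n) :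
    -s ∈ indexSums a h n := by
  rw [mem_indexSums] at *
  obtain ⟨P, N, hP, hN, hd, hc, rfl⟩ := hs
  exact ⟨N, P, hN, hP, hd.symm, by omega, by ring⟩

theorem signedSumset_image_eq {a : ℕ → ℤ} {h n : ℕ} (ha : Set.InjOn a (Icc 1 n : Finset ℕ)) :
    signedSumset h ((Icc 1 n).image a) = (indexSums a h n : Set ℤ) := by
  ext s
  simp only [signedSumset, Set.mem_ofPred_eq, mem_coe, mem_indexSums, sum_image ha]
  constructor
  · rintro ⟨f, hf, -, hc, rfl⟩
    refine ⟨{i ∈ Icc 1 n | f (a i) = 1}, {i ∈ Icc 1 n | f (a i) = -1}, filter_subset _ _,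
      filter_subset _ _, ?_, ?_, ?_⟩
    · rw [disjoint_filter]
      intro i _ h1 h2
      omega
    · zify
      rw [← hc, card_filter, card_filter]
      push_cast
      rw [← sum_add_distrib]
      refine sum_congr rfl fun i _ => ?_
      rcases hf (a i) with h | h | h <;> simp [h]
    · rw [sum_filter, sum_filter, ← sum_sub_distrib]
      refine sum_congr rfl fun i _ => ?_
      rcases hf (a i) with h | h | h <;> simp [h]
  · rintro ⟨P, N, hP, hN, hd, hc, rfl⟩
    have hmem : ∀ {S : Finset ℕ}, S ⊆ Icc 1 n → ∀ i ∈ Icc 1 n, a i ∈ S.image a ↔ i ∈ S := by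
      intro S hS i hi
      rw [mem_image]
      constructor
      · rintro ⟨j, hj, hji⟩
        rwa [← ha (by exact_mod_cast hS hj) (by exact_mod_cast hi) hji]
      · exact fun h => ⟨i, h, rfl⟩
    have hval : ∀ i ∈ Icc 1 n,
        (if a i ∈ P.image a then (1 : ℤ) else if a i ∈ N.image a then -1 else 0)
          = (if i ∈ P then 1 else 0) - (if i ∈ N then 1 else 0) := by
      intro i hi
      simp only [hmem hP i hi, hmem hN i hi]
      have : i ∈ P → i ∉ N := fun h => Finset.disjoint_left.1 hd h
      split_ifs <;> simp_all
    refine ⟨fun x => if x ∈ P.image a then 1 else if x ∈ N.image a then -1 else 0, ?_, ?_, ?_, ?_⟩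
    · intro x
      dsimp only
      split_ifs <;> simp
    · intro x hx
      have h1 : x ∉ P.image a := fun h => hx (image_subset_image hP h)
      have h2 : x ∉ N.image a := fun h => hx (image_subset_image hN h)
      simp only [h1, h2, if_false]
    · rw [← hc]
      push_cast
      have : ∀ i ∈ Icc 1 n,
          |if a i ∈ P.image a then (1 : ℤ) else if a i ∈ N.image a then -1 else 0|
          = (if i ∈ P then 1 else 0) + (if i ∈ N then 1 else 0) := by
        intro i hi
        rw [hval i hi]
        have : i ∈ P → i ∉ N := fun h => Finset.disjoint_left.1 hd h
        split_ifs <;> simp_all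
      rw [sum_congr rfl this, sum_add_distrib, sum_ite_mem, sum_ite_mem,
        inter_eq_right.2 hP, inter_eq_right.2 hN]
      simp
    · have : ∀ i ∈ Icc 1 n,
          (if a i ∈ P.image a then (1 : ℤ) else if a i ∈ N.image a then -1 else 0) * a i
          = (if i ∈ P then a i else 0) - (if i ∈ N then a i else 0) := by
        intro i hi
        rw [hval i hi]
        split_ifs <;> simp
      rw [sum_congr rfl this, sum_sub_distrib, sum_ite_mem, sum_ite_mem,
        inter_eq_right.2 hP, inter_eq_right.2 hN]

/-- Among the sums of `h` of the terms `a 1 < ⋯ < a (m + h)`, the second largest is at least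
`a (m + 1) - a m` below the largest. -/
theorem sum_add_le_sum_Ioc {a : ℕ → ℤ} {h m : ℕ} (hm : 1 ≤ m)
    (hmono : StrictMonoOn a (Set.Icc 1 (m + h))) {U : Finset ℕ} (hU : U ⊆ Icc 1 (m + h))
    (hc : #U = h) (hne : U ≠ Ioc m (m + h)) :
    ∑ i ∈ U, a i + (a (m + 1) - a m) ≤ ∑ i ∈ Ioc m (m + h), a i := by
  set T := Ioc m (m + h) with hT
  have hTc : #T = h := by simp [hT]
  have hcc : #(T \ U) = #(U \ T) := card_sdiff_comm (by omega)
  have hpos : 1 ≤ #(T \ U) := by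
    rw [Nat.one_le_iff_ne_zero, Ne, card_eq_zero, sdiff_eq_empty_iff_subset]
    exact fun hs => hne (eq_of_subset_of_card_le hs (by omega)).symm
  have hh : 1 ≤ h := by
    have := card_le_card (sdiff_subset (s := T) (t := U))
    omega
  have h1 : #(T \ U) • a (m + 1) ≤ ∑ i ∈ T \ U, a i := by
    refine card_nsmul_le_sum _ _ _ fun i hi => ?_
    simp only [hT, mem_sdiff, mem_Ioc] at hi
    exact hmono.monotoneOn ⟨by omega, by omega⟩ ⟨by omega, by omega⟩ (by omega)
  have h2 : ∑ i ∈ U \ T, a i ≤ #(U \ T) • a m := by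
    refine sum_le_card_nsmul _ _ _ fun i hi => ?_
    have hi' := mem_Icc.1 (hU (mem_sdiff.1 hi).1)
    simp only [hT, mem_sdiff, mem_Ioc] at hi
    exact hmono.monotoneOn ⟨by omega, by omega⟩ ⟨by omega, by omega⟩ (by omega)
  have h3 : a m < a (m + 1) := hmono ⟨by omega, by omega⟩ ⟨by omega, by omega⟩ (by omega)
  have h4 := sum_sdiff_sub_sum_sdiff (s₁ := U) (s₂ := T) (f := a)
  rw [← hcc] at h2
  simp only [nsmul_eq_mul] at h1 h2
  have : (1 : ℤ) ≤ #(T \ U) := by exact_mod_cast hpos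
  nlinarith

theorem eq_or_le_of_mem_indexSums {a : ℕ → ℤ} {h m : ℕ} (hm : 1 ≤ m)
    (hpos : ∀ i ∈ Icc 1 (m + h), 0 < a i)
    (hmono : StrictMonoOn a (Set.Icc 1 (m + h))) {s : ℤ} (hs : s ∈ indexSums a h (m + h)) :
    s = ∑ i ∈ Ioc m (m + h), a i ∨
      s + (a (m + 1) - a m) ≤ ∑ i ∈ Ioc m (m + h), a i := by
  obtain ⟨P, N, hP, hN, hd, hc, rfl⟩ := mem_indexSums.1 hs
  have hsum := sum_union (f := a) hd
  have hN0 : 0 ≤ ∑ i ∈ N, a i := sum_nonneg fun i hi => (hpos i (hN hi)).le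
  by_cases hU : P ∪ N = Ioc m (m + h)
  · rcases N.eq_empty_or_nonempty with rfl | ⟨i, hi⟩
    · left
      simp_all
    · right
      have h1 : a i ≤ ∑ i ∈ N, a i :=
        single_le_sum (f := a) (fun i hi => (hpos i (hN hi)).le) hi
      have hi' : i ∈ Ioc m (m + h) := hU ▸ mem_union_right _ hi
      rw [mem_Ioc] at hi'
      have h2 : a (m + 1) ≤ a i :=
        hmono.monotoneOn ⟨by omega, by omega⟩ ⟨by omega, by omega⟩ (by omega)
      have h3 : 0 < a m := hpos m (by rw [mem_Icc]; omega)
      have h4 := hpos i (hN hi)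
      rw [← hU]
      linarith
  · right
    have := sum_add_le_sum_Ioc hm hmono (union_subset hP hN)
      (by rw [card_union_of_disjoint hd, hc]) hU
    linarith

theorem le_sum_of_mem_indexSums {a : ℕ → ℤ} {h m : ℕ} (hm : 1 ≤ m) (hh : 1 ≤ h)
    (hpos : ∀ i ∈ Icc 1 (m + h), 0 < a i)
    (hmono : StrictMonoOn a (Set.Icc 1 (m + h))) {s : ℤ} (hs : s ∈ indexSums a h (m + h)) :
    s ≤ ∑ i ∈ Ioc m (m + h), a i := by
  have h3 : a m < a (m + 1) := hmono ⟨by omega, by omega⟩ ⟨by omega, by omega⟩ (by omega)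
  rcases eq_or_le_of_mem_indexSums hm hpos hmono hs with h | h <;> linarith

/-- The sums of all but one of the terms `a (m + 1), …, a (m + h + 1)`, the last one being used. -/
def topSums (a : ℕ → ℤ) (h m : ℕ) : Finset ℤ :=
  (Icc (m + 1) (m + h)).image fun j => ∑ i ∈ Ioc m (m + h + 1), a i - a j

theorem sum_Ioc_lt_of_mem_topSums {a : ℕ → ℤ} {h m : ℕ}
    (hmono : StrictMonoOn a (Set.Icc 1 (m + h + 1))) {s : ℤ} (hs : s ∈ topSums a h m) :
    ∑ i ∈ Ioc m (m + h), a i < s := by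
  simp only [topSums, mem_image, mem_Icc] at hs
  obtain ⟨j, hj, rfl⟩ := hs
  have h1 : a j < a (m + h + 1) := hmono ⟨by omega, by omega⟩ ⟨by omega, by omega⟩ (by omega)
  rw [sum_Ioc_succ_top (by omega)]
  linarith

theorem topSums_subset_indexSums {a : ℕ → ℤ} {h m : ℕ} :
    topSums a h m ⊆ indexSums a h (m + h + 1) := by
  intro s hs
  simp only [topSums, mem_image, mem_Icc] at hs
  obtain ⟨j, hj, rfl⟩ := hs
  have hjm : j ∈ Ioc m (m + h + 1) := by rw [mem_Ioc]; omega
  refine mem_indexSums.2 ⟨(Ioc m (m + h + 1)).erase j, ∅, ?_, by simp, by simp, ?_, ?_⟩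
  · refine (erase_subset _ _).trans fun i hi => ?_
    simp only [mem_Ioc, mem_Icc] at *
    omega
  · rw [card_erase_of_mem hjm]
    simp
    omega
  · rw [sum_erase_eq_sub hjm]
    simp

theorem card_topSums {a : ℕ → ℤ} {h m : ℕ}
    (hmono : StrictMonoOn a (Set.Icc 1 (m + h + 1))) : #(topSums a h m) = h := by
  rw [topSums, card_image_of_injOn]
  · simp
  · intro i hi j hj hij
    simp only [coe_Icc, Set.mem_Icc] at hi hj
    refine hmono.injOn ⟨by omega, by omega⟩ ⟨by omega, by omega⟩ ?_
    simpa using hij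

theorem card_indexSums_union {a : ℕ → ℤ} {h m : ℕ} (hm : 1 ≤ m) (hh : 1 ≤ h)
    (hpos : ∀ i ∈ Icc 1 (m + h + 1), 0 < a i)
    (hmono : StrictMonoOn a (Set.Icc 1 (m + h + 1))) :
    #(indexSums a h (m + h) ∪ (topSums a h m ∪ (topSums a h m).image Neg.neg))
      = #(indexSums a h (m + h)) + 2 * h := by
  have hpos' : ∀ i ∈ Icc 1 (m + h), 0 < a i := fun i hi => hpos i (by simp at *; omega)
  have hmono' := hmono.mono (Set.Icc_subset_Icc_right (Nat.le_add_right (m + h) 1))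
  have hM : 0 ≤ ∑ i ∈ Ioc m (m + h), a i :=
    sum_nonneg fun i hi => (hpos' i (by simp at *; omega)).le
  rw [card_union_of_disjoint, card_union_of_disjoint, card_image_of_injective _ neg_injective,
    card_topSums hmono]
  · ring
  · rw [Finset.disjoint_left]
    rintro s hs hs'
    obtain ⟨t, ht, rfl⟩ := mem_image.1 hs'
    have h1 := sum_Ioc_lt_of_mem_topSums hmono hs
    have h2 := sum_Ioc_lt_of_mem_topSums hmono ht
    linarith
  · rw [Finset.disjoint_left]
    rintro s hs hs'
    rcases mem_union.1 hs' with h | h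
    · have h1 := sum_Ioc_lt_of_mem_topSums hmono h
      have h2 := le_sum_of_mem_indexSums hm hh hpos' hmono' hs
      linarith
    · obtain ⟨t, ht, rfl⟩ := mem_image.1 h
      have h1 := sum_Ioc_lt_of_mem_topSums hmono ht
      have h2 := le_sum_of_mem_indexSums hm hh hpos' hmono' (neg_mem_indexSums hs)
      linarith

theorem indexSums_union_subset {a : ℕ → ℤ} {h m : ℕ} :
    indexSums a h (m + h) ∪ (topSums a h m ∪ (topSums a h m).image Neg.neg)
      ⊆ indexSums a h (m + h + 1) := by
  refine union_subset (indexSums_mono (by omega)) (union_subset topSums_subset_indexSums ?_)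
  intro s hs
  obtain ⟨t, ht, rfl⟩ := mem_image.1 hs
  exact neg_mem_indexSums (topSums_subset_indexSums ht)

theorem card_indexSums_add_le {a : ℕ → ℤ} {h m : ℕ} (hm : 1 ≤ m) (hh : 1 ≤ h)
    (hpos : ∀ i ∈ Icc 1 (m + h + 1), 0 < a i)
    (hmono : StrictMonoOn a (Set.Icc 1 (m + h + 1))) :
    #(indexSums a h (m + h)) + 2 * h ≤ #(indexSums a h (m + h + 1)) := by
  rw [← card_indexSums_union hm hh hpos hmono]
  exact card_le_card indexSums_union_subset

theorem indexSums_succ_eq {a : ℕ → ℤ} {h m : ℕ} (hm : 1 ≤ m) (hh : 1 ≤ h)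
    (hpos : ∀ i ∈ Icc 1 (m + h + 1), 0 < a i)
    (hmono : StrictMonoOn a (Set.Icc 1 (m + h + 1)))
    (hc : #(indexSums a h (m + h + 1)) ≤ #(indexSums a h (m + h)) + 2 * h) :
    indexSums a h (m + h) ∪ (topSums a h m ∪ (topSums a h m).image Neg.neg)
      = indexSums a h (m + h + 1) := by
  refine eq_of_subset_of_card_le indexSums_union_subset ?_
  rwa [card_indexSums_union hm hh hpos hmono]

/-- If no sums beyond the obvious ones appear when `a (m + h + 1)` is added, then each sum close
to the top leaves out exactly one of the last `h + 1` terms. -/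
theorem exists_eq_sum_sub {a : ℕ → ℤ} {h m : ℕ} (hm : 1 ≤ m) (hh : 1 ≤ h)
    (hpos : ∀ i ∈ Icc 1 (m + h + 1), 0 < a i)
    (hmono : StrictMonoOn a (Set.Icc 1 (m + h + 1)))
    (hc : #(indexSums a h (m + h + 1)) ≤ #(indexSums a h (m + h)) + 2 * h)
    {s : ℤ} (hs : s ∈ indexSums a h (m + h + 1))
    (hlt : ∑ i ∈ Ioc m (m + h), a i < s + (a (m + 1) - a m)) :
    ∃ j ∈ Icc (m + 1) (m + h + 1), s = ∑ i ∈ Ioc m (m + h + 1), a i - a j := by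
  have hpos' : ∀ i ∈ Icc 1 (m + h), 0 < a i := fun i hi => hpos i (by simp at *; omega)
  have hmono' := hmono.mono (Set.Icc_subset_Icc_right (Nat.le_add_right (m + h) 1))
  rw [← indexSums_succ_eq hm hh hpos hmono hc, mem_union, mem_union] at hs
  rcases hs with hs | hs | hs
  · rcases eq_or_le_of_mem_indexSums hm hpos' hmono' hs with rfl | h'
    · refine ⟨m + h + 1, by simp, ?_⟩
      rw [sum_Ioc_succ_top (by omega)]
      ring
    · linarith
  · simp only [topSums, mem_image, mem_Icc] at hs
    obtain ⟨j, hj, rfl⟩ := hs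
    exact ⟨j, by rw [mem_Icc]; omega, rfl⟩
  · obtain ⟨t, ht, rfl⟩ := mem_image.1 hs
    have h1 := sum_Ioc_lt_of_mem_topSums hmono ht
    have h2 : a (m + 1) ≤ ∑ i ∈ Ioc m (m + h), a i :=
      single_le_sum (f := a) (fun i hi => (hpos' i (by simp at *; omega)).le)
        (by rw [mem_Ioc]; omega)
    have h3 := hpos m (by rw [mem_Icc]; omega)
    have h4 := hpos (m + 1) (by rw [mem_Icc]; omega)
    linarith

theorem succ_sub_eq_of_card_le {a : ℕ → ℤ} {h m : ℕ} (hm : 1 ≤ m)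
    (hpos : ∀ i ∈ Icc 1 (m + h + 1), 0 < a i)
    (hmono : StrictMonoOn a (Set.Icc 1 (m + h + 1)))
    (hc : #(indexSums a h (m + h + 1)) ≤ #(indexSums a h (m + h)) + 2 * h)
    {j : ℕ} (hmj : m + 2 ≤ j) (hjm : j ≤ m + h) :
    a (j + 1) - a j = a (m + 1) - a m := by
  have hlt : ∀ {i j : ℕ}, 1 ≤ i → i < j → j ≤ m + h + 1 → a i < a j :=
    fun h1 h2 h3 => hmono ⟨by omega, by omega⟩ ⟨by omega, by omega⟩ h2
  have key : ∀ j, m + 2 ≤ j → j ≤ m + h →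
      ∃ i, j < i ∧ i ≤ m + h + 1 ∧ a i = a j + (a (m + 1) - a m) := by
    intro j hj1 hj2
    have hsub : ({j, m + 1} : Finset ℕ) ⊆ Ioc m (m + h + 1) := by
      intro i hi
      simp only [mem_insert, mem_singleton, mem_Ioc] at *
      omega
    have hne : j ≠ m + 1 := by omega
    have hm' : m ∉ Ioc m (m + h + 1) \ {j, m + 1} := by simp
    have hmem : ∑ i ∈ Ioc m (m + h + 1), a i - a j - (a (m + 1) - a m)
        ∈ indexSums a h (m + h + 1) := by
      refine mem_indexSums.2 ⟨insert m (Ioc m (m + h + 1) \ {j, m + 1}), ∅, ?_, by simp, by simp,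
        ?_, ?_⟩
      · intro i hi
        simp only [mem_insert, mem_sdiff, mem_Ioc, mem_Icc] at *
        omega
      · rw [card_insert_of_notMem hm', card_sdiff_of_subset hsub, card_pair hne]
        simp
        omega
      · rw [sum_insert hm', sum_sdiff_eq_sub hsub, sum_pair hne]
        simp
        ring
    obtain ⟨i, hi, he⟩ := exists_eq_sum_sub hm (by omega) hpos hmono hc hmem (by
      have := hlt (i := j) (j := m + h + 1) (by omega) (by omega) le_rfl
      rw [sum_Ioc_succ_top (by omega)]
      linarith)
    rw [mem_Icc] at hi
    refine ⟨i, ?_, hi.2, by linarith⟩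
    by_contra hij
    have h1 : a i ≤ a j := hmono.monotoneOn ⟨by omega, by omega⟩ ⟨by omega, by omega⟩ (by omega)
    have h2 := hlt (i := m) (j := m + 1) hm (by omega) (by omega)
    linarith
  clear hc
  induction hjm using Nat.decreasingInduction with
  | self =>
    obtain ⟨i, h1, h2, h3⟩ := key (m + h) hmj le_rfl
    obtain rfl : i = m + h + 1 := by omega
    linarith
  | of_succ j hj ih =>
    specialize ih (by omega)
    obtain ⟨i, h1, h2, h3⟩ := key j hmj (by omega)
    have h4 := hlt (i := j) (j := j + 1) (by omega) (by omega) (by omega)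
    have h5 : i < j + 2 := by
      by_contra hij
      have h6 : a (j + 1 + 1) ≤ a i :=
        hmono.monotoneOn ⟨by omega, by omega⟩ ⟨by omega, by omega⟩ (by omega)
      linarith
    obtain rfl : i = j + 1 := by omega
    linarith

/-- Every integer between `l * h` and `l * h + h` is of the form `i + 2 * ∑ j ∈ J, j` where `J` is
an `l`-subset of `{0, …, h}` not containing `i`. -/
theorem exists_add_two_mul_sum_eq_of_two_mul_le (h l : ℕ) (hl : 2 * l ≤ h) (h0 : l = 0 ∨ 1 ≤ h)
    (hne : h ≠ 2 ∨ l ≠ 1) {r : ℕ} (hr : l * h ≤ r) (hr' : r ≤ l * h + h) :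
    ∃ (i : ℕ) (J : Finset ℕ), i ≤ h ∧ J ⊆ range (h + 1) ∧ i ∉ J ∧ #J = l ∧
      i + 2 * ∑ j ∈ J, j = r := by
  induction l using Nat.twoStepInduction generalizing h r with
  | zero => exact ⟨r, ∅, by omega, by simp, by simp, by simp, by simp⟩
  | one =>
    obtain ⟨i, j, hi, hj, hij, he⟩ : ∃ i j, i ≤ h ∧ j ≤ h ∧ i ≠ j ∧ i + 2 * j = r := by
      by_cases hb : 3 * ((r - h + 1) / 2) = r
      · exact ⟨r - 2 * ((r - h + 1) / 2 + 1), (r - h + 1) / 2 + 1, by omega, by omega, by omega,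
          by omega⟩
      · exact ⟨r - 2 * ((r - h + 1) / 2), (r - h + 1) / 2, by omega, by omega, by omega, by omega⟩
    exact ⟨i, {j}, hi, by simpa using by omega, by simpa, by simp, by simpa⟩
  | more l ih _ =>
    by_cases h4 : h = 4
    · obtain rfl : l = 0 := by omega
      subst h4
      interval_cases r
      · exact ⟨0, {1, 3}, by decide⟩
      · exact ⟨1, {0, 4}, by decide⟩
      · exact ⟨4, {1, 2}, by decide⟩
      · exact ⟨3, {0, 4}, by decide⟩
      · exact ⟨2, {1, 4}, by decide⟩
    by_cases h6 : h = 6 ∧ l = 1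
    · obtain ⟨rfl, rfl⟩ := h6
      interval_cases r
      · exact ⟨0, {1, 2, 6}, by decide⟩
      · exact ⟨1, {0, 3, 6}, by decide⟩
      · exact ⟨2, {0, 3, 6}, by decide⟩
      · exact ⟨3, {1, 2, 6}, by decide⟩
      · exact ⟨4, {1, 2, 6}, by decide⟩
      · exact ⟨5, {1, 2, 6}, by decide⟩
      · exact ⟨4, {1, 3, 6}, by decide⟩
    obtain ⟨g, rfl⟩ : ∃ g, h = g + 4 := ⟨h - 4, by omega⟩
    have hexp : (l + 2) * (g + 4) = l * g + 4 * l + 2 * g + 8 := by ring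
    rw [hexp] at hr hr'
    obtain ⟨x, y, s, hx, hy, hy', hs, hs', rfl⟩ : ∃ x y s, x ≤ 1 ∧ g + 3 ≤ y ∧ y ≤ g + 4 ∧
        l * g ≤ s ∧ s ≤ l * g + g ∧ r = s + 4 * l + 2 + 2 * (x + y) := by
      generalize l * g = q at hr hr'
      rcases le_or_gt r (q + 4 * l + 2 * g + 8 + g) with h1 | h1
      · exact ⟨0, g + 3, r - (4 * l + 2 * g + 8), by omega⟩
      rcases le_or_gt r (q + 4 * l + 2 * g + 8 + g + 2) with h2 | h2
      · exact ⟨1, g + 3, r - (4 * l + 2 * g + 10), by omega⟩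
      · exact ⟨1, g + 4, r - (4 * l + 2 * g + 12), by omega⟩
    obtain ⟨i, J, hi, hJ, hiJ, hc, he⟩ := ih g (by omega) (by omega) (by omega) hs hs'
    have hJ' : ∀ j ∈ J, j ≤ g := fun j hj => by
      have := mem_range.1 (hJ hj)
      omega
    have hyJ : y ∉ J.map (addRightEmbedding 2) := by
      simp only [mem_map, addRightEmbedding_apply, not_exists, not_and]
      intro j hj
      have := hJ' j hj
      omega
    have hxJ : x ∉ insert y (J.map (addRightEmbedding 2)) := by
      simp only [mem_insert, mem_map, addRightEmbedding_apply, not_or, not_exists, not_and]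
      exact ⟨by omega, fun j _ => by omega⟩
    refine ⟨i + 2, insert x (insert y (J.map (addRightEmbedding 2))), by omega, ?_, ?_, ?_, ?_⟩
    · intro j hj
      simp only [mem_insert, mem_map, addRightEmbedding_apply, mem_range] at *
      rcases hj with rfl | rfl | ⟨j, hj, rfl⟩
      · omega
      · omega
      · have := hJ' j hj
        omega
    · simp only [mem_insert, mem_map, addRightEmbedding_apply, not_or, not_exists, not_and]
      refine ⟨by omega, by omega, fun j hj hji => ?_⟩
      obtain rfl : j = i := by omega
      exact hiJ hj
    · rw [card_insert_of_notMem hxJ, card_insert_of_notMem hyJ, card_map, hc]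
    · rw [sum_insert hxJ, sum_insert hyJ, sum_map]
      simp only [addRightEmbedding_apply, sum_add_distrib, sum_const, hc, smul_eq_mul]
      omega

theorem exists_add_two_mul_sum_eq {h l : ℕ} (hh : 3 ≤ h) (hl : l ≤ h) {r : ℕ}
    (hr : l * h ≤ r) (hr' : r ≤ l * h + h) :
    ∃ (i : ℕ) (J : Finset ℕ), i ≤ h ∧ J ⊆ range (h + 1) ∧ i ∉ J ∧ #J = l ∧
      i + 2 * ∑ j ∈ J, j = r := by
  rcases le_or_gt (2 * l) h with h2 | h2
  · exact exists_add_two_mul_sum_eq_of_two_mul_le h l h2 (by omega) (by omega) hr hr'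
  have hlh : l * h ≤ h * h := Nat.mul_le_mul_right h hl
  have hsub : (h - l) * h = h * h - l * h := Nat.sub_mul h l h
  have hexp : (h + 1) * h = h * h + h := by ring
  obtain ⟨i, J, hi, hJ, hiJ, hc, he⟩ := exists_add_two_mul_sum_eq_of_two_mul_le h (h - l)
    (by omega) (by omega) (by omega) (r := (h + 1) * h - r) (by omega) (by omega)
  have hins : insert i J ⊆ range (h + 1) := insert_subset (by simpa using by omega) hJ
  refine ⟨i, range (h + 1) \ insert i J, hi, sdiff_subset, by simp, ?_, ?_⟩
  · rw [card_sdiff_of_subset hins, card_insert_of_notMem hiJ, card_range]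
    omega
  · have h1 := sum_sdiff (f := fun j : ℕ => j) hins
    have h3 := Finset.sum_range_id_mul_two (h + 1)
    rw [sum_insert hiJ] at h1
    simp only [Nat.add_sub_cancel] at h3
    omega

theorem sum_sub_mem_indexSums {a : ℕ → ℤ} {h : ℕ} {d : ℤ}
    (ha : ∀ i ≤ h, a (i + 1) = a 1 + i * d) {i : ℕ} {J : Finset ℕ} (hi : i ≤ h)
    (hJ : J ⊆ range (h + 1)) (hiJ : i ∉ J) :
    ∑ j ∈ range (h + 1), a (j + 1) - a 1 - 2 * #J * a 1 - d * (i + 2 * ∑ j ∈ J, j : ℕ)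
      ∈ indexSums a h (h + 1) := by
  have hins : insert i J ⊆ range (h + 1) := insert_subset (by simpa using by omega) hJ
  have hsub : ∀ {S : Finset ℕ}, S ⊆ range (h + 1) →
      S.map (addRightEmbedding 1) ⊆ Icc 1 (h + 1) := by
    intro S hS j hj
    simp only [mem_map, addRightEmbedding_apply, mem_Icc] at *
    obtain ⟨j, hj, rfl⟩ := hj
    have := mem_range.1 (hS hj)
    omega
  refine mem_indexSums.2 ⟨(range (h + 1) \ insert i J).map (addRightEmbedding 1),
    J.map (addRightEmbedding 1), hsub sdiff_subset, hsub hJ, ?_, ?_, ?_⟩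
  · rw [disjoint_map]
    exact sdiff_disjoint.mono_right (subset_insert _ _)
  · have := card_le_card hins
    rw [card_insert_of_notMem hiJ, card_range] at this
    rw [card_map, card_map, card_sdiff_of_subset hins, card_insert_of_notMem hiJ, card_range]
    omega
  · have hsum : ∑ j ∈ J, a (j + 1) = #J * a 1 + d * (∑ j ∈ J, j : ℕ) := by
      rw [sum_congr rfl fun j hj => ha j (by have := mem_range.1 (hJ hj); omega),
        sum_add_distrib, ← sum_mul]
      push_cast
      simp
      ring
    rw [sum_map, sum_map]
    simp only [addRightEmbedding_apply]
    rw [sum_sdiff_eq_sub hins, sum_insert hiJ, hsum, ha i hi]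
    push_cast
    ring

/-- An arithmetic progression of length `h + 1` whose difference is less than twice its first term
has more than `(h + 1) ^ 2` restricted `h`-fold signed sums. -/
theorem sq_lt_card_indexSums {a : ℕ → ℤ} {h : ℕ} {d : ℤ} (hh : 3 ≤ h) (hd : 0 < d)
    (ha : ∀ i ≤ h, a (i + 1) = a 1 + i * d) (hlt : d < 2 * a 1) :
    (h + 1) ^ 2 < #(indexSums a h (h + 1)) := by
  set S := ∑ j ∈ range (h + 1), a (j + 1) with hS
  let x : ℕ → ℤ := fun n =>
    S - a 1 - 2 * (n / (h + 1) : ℕ) * a 1 - d * (n - n / (h + 1) : ℕ)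
  have hx : ∀ n, x n = S - a 1 - (n / (h + 1) : ℕ) * (2 * a 1 - d) - d * n := by
    intro n
    simp only [x]
    rw [Nat.cast_sub (Nat.div_le_self _ _)]
    ring
  have hanti : StrictAnti x := by
    intro m n hmn
    rw [hx, hx]
    have h1 : ((m / (h + 1) : ℕ) : ℤ) ≤ (n / (h + 1) : ℕ) := by
      exact_mod_cast Nat.div_le_div_right hmn.le
    have h2 : (m : ℤ) < n := by exact_mod_cast hmn
    nlinarith
  have hmem : ∀ n < (h + 1) ^ 2, x n ∈ indexSums a h (h + 1) := by
    intro n hn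
    have hl : n / (h + 1) ≤ h := by
      rw [← Nat.lt_succ_iff, Nat.div_lt_iff_lt_mul (by omega)]
      rwa [sq] at hn
    have hdm := Nat.div_add_mod n (h + 1)
    have hmod := Nat.mod_lt n (show h + 1 > 0 by omega)
    have hexp : (h + 1) * (n / (h + 1)) = n / (h + 1) * h + n / (h + 1) := by ring
    obtain ⟨i, J, hi, hJ, hiJ, hc, he⟩ :=
      exists_add_two_mul_sum_eq hh hl (r := n - n / (h + 1)) (by omega) (by omega)
    have := sum_sub_mem_indexSums ha hi hJ hiJ
    rwa [hc, he] at this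
  have hy := sum_sub_mem_indexSums ha (i := h - 1) (J := {0}) (by omega) (by simp)
    (by simpa using by omega)
  rw [← hS] at hy
  simp only [card_singleton, sum_singleton, mul_zero, add_zero] at hy
  rw [Nat.cast_sub (by omega)] at hy
  push_cast at hy
  have hnot : S - a 1 - 2 * a 1 - d * (h - 1) ∉ (range ((h + 1) ^ 2)).image x := by
    simp only [mem_image, not_exists, not_and]
    intro n _ he
    rw [hx] at he
    rcases le_or_gt n h with hn | hn
    · rw [Nat.div_eq_of_lt (by omega)] at he
      have : (n : ℤ) ≤ h := by exact_mod_cast hn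
      push_cast at he
      nlinarith
    · have h1 : (1 : ℤ) ≤ (n / (h + 1) : ℕ) := by
        exact_mod_cast (Nat.one_le_div_iff (by omega)).2 (by omega)
      have h2 : (h : ℤ) + 1 ≤ n := by exact_mod_cast hn
      nlinarith
  have hle := card_le_card (s := insert _ ((range ((h + 1) ^ 2)).image x))
    (insert_subset hy (image_subset_iff.2 fun n hn => hmem n (mem_range.1 hn)))
  rw [card_insert_of_notMem hnot, card_image_of_injective _ hanti.injective, card_range] at hle
  omega

theorem stmt10 (h k : ℕ) (hh : 4 ≤ h) (hhk : h ≤ k - 3) (hk : 7 ≤ k)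
    (a : ℕ → ℤ) (hpos : ∀ i ∈ Finset.Icc 1 k, 0 < a i)
    (hmono : ∀ i ∈ Finset.Icc 1 k, ∀ j ∈ Finset.Icc 1 k, i < j → a i < a j)
    (hcard : (signedSumset h ((Finset.Icc 1 k).image a)).ncard
      = 2 * h * k - h ^ 2 + 1)
    (hsub : (h + 1) ^ 2 ≤
      (signedSumset h ((Finset.Icc 1 (h + 1)).image a)).ncard) :
    (Finset.Icc 1 k).image a =
      (Finset.Icc 1 k).image (fun i : ℕ => a 1 * (2 * (i : ℤ) - 1)) := by
  have hM : StrictMonoOn a (Set.Icc 1 k) := fun i hi j hj hij =>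
    hmono i (mem_Icc.2 hi) j (mem_Icc.2 hj) hij
  obtain ⟨p, rfl⟩ : ∃ p, k = p + h := ⟨k - h, by omega⟩
  have hM' : ∀ {n}, n ≤ p + h → StrictMonoOn a (Set.Icc 1 n) := fun hn =>
    hM.mono (Set.Icc_subset_Icc_right hn)
  have hpos' : ∀ {n}, n ≤ p + h → ∀ i ∈ Icc 1 n, 0 < a i := fun hn i hi =>
    hpos i (Icc_subset_Icc_right hn hi)
  have hinj : ∀ {n}, n ≤ p + h → Set.InjOn a (Icc 1 n : Finset ℕ) := fun hn => by
    rw [coe_Icc]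
    exact (hM' hn).injOn
  rw [signedSumset_image_eq (hinj le_rfl), Set.ncard_coe_finset] at hcard
  rw [signedSumset_image_eq (hinj (by omega)), Set.ncard_coe_finset, add_comm h 1] at hsub
  have hcard' : #(indexSums a h (p + h)) = 2 * h * p + h ^ 2 + 1 := by
    rw [hcard, show 2 * h * (p + h) = 2 * h * p + h ^ 2 + h ^ 2 by ring, Nat.add_sub_cancel]
  have hstep : ∀ m n, 1 ≤ m → m + n ≤ p →
      #(indexSums a h (m + h)) + 2 * h * n ≤ #(indexSums a h (m + n + h)) := by
    intro m n hm hn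
    induction n with
    | zero => simp
    | succ n ih =>
      have h1 := ih (by omega)
      have h2 := card_indexSums_add_le (a := a) (h := h) (m := m + n) (by omega) (by omega)
        (hpos' (by omega)) (hM' (by omega))
      rw [show m + (n + 1) + h = m + n + h + 1 by ring, Nat.mul_succ]
      omega
  have hle : ∀ m, 1 ≤ m → m < p →
      #(indexSums a h (m + h + 1)) ≤ #(indexSums a h (m + h)) + 2 * h := by
    intro m hm hmp
    have h1 := hstep 1 (m - 1) le_rfl (by omega)
    have h2 := hstep (m + 1) (p - (m + 1)) (by omega) (by omega)
    rw [show m + 1 + (p - (m + 1)) = p by omega, hcard', show m + 1 + h = m + h + 1 by ring] at h2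
    rw [show 1 + (m - 1) = m by omega] at h1
    obtain ⟨q, rfl⟩ : ∃ q, p = m + 1 + q := ⟨p - (m + 1), by omega⟩
    obtain ⟨m, rfl⟩ : ∃ m', m = m' + 1 := ⟨m - 1, by omega⟩
    simp only [Nat.add_sub_cancel, Nat.add_sub_cancel_left] at h1 h2
    nlinarith
  have hdiff : ∀ m j, 1 ≤ m → m < p → m + 2 ≤ j → j ≤ m + h →
      a (j + 1) - a j = a (m + 1) - a m := fun m j hm hmp h1 h2 =>
    succ_sub_eq_of_card_le hm (hpos' (by omega)) (hM' (by omega)) (hle m hm hmp) h1 h2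
  have hconst : ∀ j, 1 ≤ j → j < p + h → a (j + 1) - a j = a 2 - a 1 := by
    intro j
    induction j using Nat.strong_induction_on with
    | _ j ih =>
      intro hj hjk
      rcases (by omega : j = 1 ∨ j = 2 ∨ 3 ≤ j) with rfl | rfl | hj3
      · rfl
      · have h1 := hdiff 1 4 le_rfl (by omega) (by omega) (by omega)
        have h2 := hdiff 2 4 (by omega) (by omega) (by omega) (by omega)
        simp only [Nat.reduceAdd] at *
        linarith
      · rw [hdiff (min (j - 2) (p - 1)) j (by omega) (by omega) (by omega) (by omega)]
        exact ih _ (by omega) (by omega) (by omega)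
  set d := a 2 - a 1 with hd
  have hd0 : 0 < d := sub_pos.2 (hM ⟨by omega, by omega⟩ ⟨by omega, by omega⟩ (by omega))
  have hap : ∀ i, i < p + h → a (i + 1) = a 1 + i * d := by
    intro i hi
    induction i with
    | zero => simp
    | succ i ih =>
      have h1 := ih (by omega)
      have h2 := hconst (i + 1) (by omega) hi
      push_cast
      linarith
  have hpos1 := hpos 1 (by rw [mem_Icc]; omega)
  have hd2 : d = 2 * a 1 := by
    refine le_antisymm ?_ ?_
    · by_contra! hlt
      have ha2 : a 2 = a 1 + d := by rw [hd]; ring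
      have ha3 : a 3 = a 1 + 2 * d := by simpa using hap 2 (by omega)
      have hah : a (1 + h + 1) = a 1 + (1 + h : ℕ) * d := hap (1 + h) (by omega)
      have hmem : ∑ i ∈ Ioc 1 (1 + h + 1), a i - a 2 - a 3 - a 1 ∈ indexSums a h (1 + h + 1) := by
        have hs : ({2, 3} : Finset ℕ) ⊆ Ioc 1 (1 + h + 1) := by
          intro i hi
          simp only [mem_insert, mem_singleton, mem_Ioc] at *
          omega
        refine mem_indexSums.2 ⟨Ioc 1 (1 + h + 1) \ {2, 3}, {1}, ?_, by simp, by simp, ?_, ?_⟩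
        · intro i hi
          simp only [mem_sdiff, mem_Ioc, mem_Icc] at *
          omega
        · rw [card_sdiff_of_subset hs, card_pair (by omega)]
          simp
          omega
        · rw [sum_sdiff_eq_sub hs, sum_pair (by omega)]
          simp
          ring
      obtain ⟨j, hj, he⟩ := exists_eq_sum_sub (a := a) (h := h) (m := 1) le_rfl (by omega)
        (hpos' (by omega)) (hM' (by omega)) (hle 1 le_rfl (by omega)) hmem (by
          rw [sum_Ioc_succ_top (by omega), hah, ha2, ha3]
          push_cast
          have : (4 : ℤ) ≤ h := by exact_mod_cast hh
          nlinarith)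
      rw [mem_Icc] at hj
      obtain ⟨j, rfl⟩ : ∃ j', j = j' + 1 := ⟨j - 1, by omega⟩
      rw [hap j (by omega), ha2, ha3] at he
      have h1 : 2 * a 1 = (j - 3) * d := by linarith
      have h2 : (0 : ℤ) < j - 3 := by
        by_contra!
        nlinarith
      have h3 : (1 : ℤ) ≤ j - 3 := h2
      nlinarith
    · by_contra! hlt
      have h1 := sq_lt_card_indexSums (a := a) (h := h) (by omega) hd0
        (fun i hi => hap i (by omega)) hlt
      have h2 := hstep 1 (p - 1) le_rfl (by omega)
      rw [show 1 + (p - 1) = p by omega, hcard', add_comm 1 h] at h2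
      obtain ⟨q, rfl⟩ : ∃ q, p = q + 1 := ⟨p - 1, by omega⟩
      simp only [Nat.add_sub_cancel] at h2
      nlinarith
  refine image_congr fun i hi => ?_
  rw [mem_coe, mem_Icc] at hi
  obtain ⟨i, rfl⟩ : ∃ i', i = i' + 1 := ⟨i - 1, by omega⟩
  rw [hap i (by omega), hd2]
  push_cast
  ring
end

section
/- Let h ≥ 3 and let A = {a₁ < a₂ < ⋯ < a_{h+1}} be a set of h+1 positive integers satisfying aᵢ ≥ a_{i−1} + a_{i−2} for all i = 4, …, h+1. Then |h^∧_± A| ≥ (h+1)² + 1. -/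
open Finset

/-- Signed sums of `a 1, …, a n` in which exactly one term is omitted. -/
def omitOneSums (a : ℕ → ℤ) (n : ℕ) : Set ℤ :=
  {s | ∃ g : ℕ → ℤ, (∀ i, g i = -1 ∨ g i = 0 ∨ g i = 1) ∧
    (∑ i ∈ Finset.Icc 1 n, |g i|) + 1 = (n : ℤ) ∧ s = ∑ i ∈ Finset.Icc 1 n, g i * a i}

lemma neg_mem_omitOneSums {a : ℕ → ℤ} {n : ℕ} {s : ℤ} (hs : s ∈ omitOneSums a n) :
    -s ∈ omitOneSums a n := by
  obtain ⟨g, hg, hsum, rfl⟩ := hs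
  refine ⟨fun i => -g i, fun i => ?_, by simpa using hsum, by simp⟩
  have := hg i
  dsimp only
  omega

lemma add_mul_mem_omitOneSums {a : ℕ → ℤ} {n : ℕ} {s e : ℤ} (hs : s ∈ omitOneSums a n)
    (he : e = -1 ∨ e = 1) : s + e * a (n + 1) ∈ omitOneSums a (n + 1) := by
  obtain ⟨g, hg, hsum, rfl⟩ := hs
  have hne : ∀ i ∈ Finset.Icc 1 n, i ≠ n + 1 := fun i hi => by
    have := Finset.mem_Icc.1 hi
    omega
  refine ⟨fun i => if i = n + 1 then e else g i, fun i => ?_, ?_, ?_⟩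
  · dsimp only
    split_ifs
    · tauto
    · exact hg i
  · rw [Finset.sum_Icc_succ_top (by omega),
      Finset.sum_congr rfl (g := fun i => |g i|) fun i hi => by simp [hne i hi]]
    have : |e| = 1 := by rcases he with rfl | rfl <;> simp
    simp only [if_true, this]
    push_cast
    omega
  · rw [Finset.sum_Icc_succ_top (by omega)]
    congr 1
    · exact Finset.sum_congr rfl fun i hi => by simp [hne i hi]
    · simp

lemma mem_omitOneSums_four (a : ℕ → ℤ) {s : ℤ} (e₁ e₂ e₃ e₄ : ℤ)
    (h₁ : e₁ = -1 ∨ e₁ = 0 ∨ e₁ = 1) (h₂ : e₂ = -1 ∨ e₂ = 0 ∨ e₂ = 1)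
    (h₃ : e₃ = -1 ∨ e₃ = 0 ∨ e₃ = 1) (h₄ : e₄ = -1 ∨ e₄ = 0 ∨ e₄ = 1)
    (habs : |e₁| + |e₂| + |e₃| + |e₄| = 3)
    (hs : s = e₁ * a 1 + e₂ * a 2 + e₃ * a 3 + e₄ * a 4) : s ∈ omitOneSums a 4 := by
  refine ⟨fun i => if i = 1 then e₁ else if i = 2 then e₂ else if i = 3 then e₃ else e₄,
    fun i => ?_, ?_, ?_⟩
  · dsimp only
    split_ifs <;> assumption
  · simp [Finset.sum_Icc_succ_top, habs]
  · simp [Finset.sum_Icc_succ_top, hs]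

lemma exists_nonneg_omitOneSums_four (a : ℕ → ℤ) (h0 : 0 < a 1) (h12 : a 1 < a 2)
    (h23 : a 2 < a 3) (h4 : a 3 + a 2 ≤ a 4) :
    ∃ G : Finset ℤ, 9 ≤ G.card ∧
      ∀ s ∈ G, s ∈ omitOneSums a 4 ∧ 0 ≤ s ∧ s < 2 * a 4 + a 3 := by
  suffices H : ∃ y, y ∈ omitOneSums a 4 ∧ 0 ≤ y ∧ y < 2 * a 4 + a 3 ∧
      y ∉ [a 4 + (a 2 + a 3), a 4 + (a 1 + a 3), a 4 + (a 1 + a 2), a 4 + (a 2 - a 1),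
        a 4 - (a 2 - a 1), a 4 - (a 1 + a 2), a 4 - (a 1 + a 3), a 4 - (a 2 + a 3)] by
    obtain ⟨y, hy, hy0, hy1, hyn⟩ := H
    have hnd := List.nodup_cons.2 ⟨hyn, (by
      simp only [List.nodup_cons, List.mem_cons, List.not_mem_nil, not_or, or_false,
        not_false_eq_true, List.nodup_nil, and_true]
      omega)⟩
    refine ⟨_, (List.toFinset_card_of_nodup hnd).ge, fun s hs => ?_⟩
    simp only [List.mem_toFinset, List.mem_cons, List.not_mem_nil, or_false] at hs
    refine ⟨?_, by omega, by omega⟩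
    rcases hs with rfl | rfl | rfl | rfl | rfl | rfl | rfl | rfl | rfl
    · exact hy
    · exact mem_omitOneSums_four a 0 1 1 1 (by simp) (by simp) (by simp) (by simp) (by simp)
        (by ring)
    · exact mem_omitOneSums_four a 1 0 1 1 (by simp) (by simp) (by simp) (by simp) (by simp)
        (by ring)
    · exact mem_omitOneSums_four a 1 1 0 1 (by simp) (by simp) (by simp) (by simp) (by simp)
        (by ring)
    · exact mem_omitOneSums_four a (-1) 1 0 1 (by simp) (by simp) (by simp) (by simp) (by simp)
        (by ring)
    · exact mem_omitOneSums_four a 1 (-1) 0 1 (by simp) (by simp) (by simp) (by simp) (by simp)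
        (by ring)
    · exact mem_omitOneSums_four a (-1) (-1) 0 1 (by simp) (by simp) (by simp) (by simp) (by simp)
        (by ring)
    · exact mem_omitOneSums_four a (-1) 0 (-1) 1 (by simp) (by simp) (by simp) (by simp) (by simp)
        (by ring)
    · exact mem_omitOneSums_four a 0 (-1) (-1) 1 (by simp) (by simp) (by simp) (by simp) (by simp)
        (by ring)
  simp only [List.mem_cons, List.not_mem_nil, not_or, or_false]
  by_cases hca : a 3 - a 1 = a 1 + a 2
  · by_cases hcb : a 3 - a 2 = a 2 - a 1
    · by_cases hd : a 4 = 9 * a 1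
      · exact ⟨a 1 + a 2 + a 3, mem_omitOneSums_four a 1 1 1 0 (by simp) (by simp) (by simp)
          (by simp) (by simp) (by ring), by omega, by omega, by omega⟩
      · exact ⟨a 3 - a 2 - a 1, mem_omitOneSums_four a (-1) (-1) 1 0 (by simp) (by simp)
          (by simp) (by simp) (by simp) (by ring), by omega, by omega, by omega⟩
    · exact ⟨a 4 + (a 3 - a 2), mem_omitOneSums_four a 0 (-1) 1 1 (by simp) (by simp)
        (by simp) (by simp) (by simp) (by ring), by omega, by omega, by omega⟩
  · exact ⟨a 4 + (a 3 - a 1), mem_omitOneSums_four a (-1) 0 1 1 (by simp) (by simp)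
      (by simp) (by simp) (by simp) (by ring), by omega, by omega, by omega⟩

lemma two_mul_card_le_card_union_neg (G : Finset ℤ) (hG : ∀ s ∈ G, 0 ≤ s) :
    2 * G.card ≤ (G ∪ G.image (-·)).card + 1 := by
  have h1 := Finset.card_union_add_card_inter G (G.image (-·))
  have h2 : (G.image (-·)).card = G.card := Finset.card_image_of_injective _ neg_injective
  have h3 : (G ∩ G.image (-·)).card ≤ 1 := by
    rw [← Finset.card_singleton (0 : ℤ)]
    refine Finset.card_le_card fun x hx => ?_
    simp only [Finset.mem_inter, Finset.mem_image] at hx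
    obtain ⟨hx, y, hy, rfl⟩ := hx
    have := hG _ hx
    have := hG _ hy
    simp only [Finset.mem_singleton]
    omega
  omega

lemma card_le_two_mul_card_filter_nonpos (S : Finset ℤ) (hS : ∀ s ∈ S, -s ∈ S) :
    S.card ≤ 2 * (S.filter (· ≤ 0)).card := by
  have hsub : S ⊆ S.filter (· ≤ 0) ∪ (S.filter (· ≤ 0)).image (-·) := fun x hx => by
    simp only [Finset.mem_union, Finset.mem_filter, Finset.mem_image]
    rcases le_total x 0 with h | h
    · exact Or.inl ⟨hx, h⟩
    · exact Or.inr ⟨-x, ⟨hS x hx, by omega⟩, by simp⟩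
  have h1 := Finset.card_le_card hsub
  have h2 := Finset.card_union_le (S.filter (· ≤ 0)) ((S.filter (· ≤ 0)).image (-·))
  have h3 := Finset.card_image_le (s := S.filter (· ≤ 0)) (f := (-·))
  omega

/-- The shifts by `d` and by `-d` of a symmetric set bounded by twice `d` together have at least
`3 / 2` times as many points as the set. -/
lemma three_mul_card_le_card_shifts (S : Finset ℤ) (d : ℤ) (hS : ∀ s ∈ S, -s ∈ S)
    (hd : ∀ s ∈ S, s < 2 * d) :
    3 * S.card ≤ 2 * (S.image (· + d) ∪ S.image (· - d)).card := by
  have hdisj : Disjoint (S.image (· + d)) ((S.filter (· ≤ 0)).image (· - d)) := by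
    rw [Finset.disjoint_left]
    intro x hx hx'
    simp only [Finset.mem_image, Finset.mem_filter] at hx hx'
    obtain ⟨u, hu, rfl⟩ := hx
    obtain ⟨t, ⟨-, ht⟩, htu⟩ := hx'
    have := hd _ (hS u hu)
    omega
  have h1 := Finset.card_union_of_disjoint hdisj
  have h2 : (S.image (· + d)).card = S.card :=
    Finset.card_image_of_injective _ (add_left_injective d)
  have h3 : ((S.filter (· ≤ 0)).image (· - d)).card = (S.filter (· ≤ 0)).card :=
    Finset.card_image_of_injective _ sub_left_injective
  have h4 : (S.image (· + d) ∪ (S.filter (· ≤ 0)).image (· - d)).card ≤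
      (S.image (· + d) ∪ S.image (· - d)).card :=
    Finset.card_le_card (Finset.union_subset_union_right
      (Finset.image_subset_image (Finset.filter_subset _ _)))
  have h5 := card_le_two_mul_card_filter_nonpos S hS
  omega

lemma exists_symmetric_omitOneSums (a : ℕ → ℤ) (N : ℕ) (h0 : 0 < a 1) (h12 : a 1 < a 2)
    (h23 : a 2 < a 3) (hgrow : ∀ i ∈ Finset.Icc 4 N, a (i - 1) + a (i - 2) ≤ a i)
    (hpos : ∀ i ∈ Finset.Icc 1 N, 0 < a i) (n : ℕ) (hn : 4 ≤ n) (hnN : n ≤ N) :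
    ∃ S : Finset ℤ, (∀ s ∈ S, s ∈ omitOneSums a n) ∧ (∀ s ∈ S, -s ∈ S) ∧
      (∀ s ∈ S, s < 2 * a n + a (n - 1)) ∧ n ^ 2 + 1 ≤ S.card := by
  induction n, hn using Nat.le_induction with
  | base =>
    have h4 : a 3 + a 2 ≤ a 4 := hgrow 4 (Finset.mem_Icc.2 ⟨le_rfl, hnN⟩)
    obtain ⟨G, hcard, hG⟩ := exists_nonneg_omitOneSums_four a h0 h12 h23 h4
    have h := two_mul_card_le_card_union_neg G fun s hs => (hG s hs).2.1
    refine ⟨G ∪ G.image (-·), fun s hs => ?_, fun s hs => ?_, fun s hs => ?_, by omega⟩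
    · rcases Finset.mem_union.1 hs with hs | hs
      · exact (hG s hs).1
      · obtain ⟨t, ht, rfl⟩ := Finset.mem_image.1 hs
        exact neg_mem_omitOneSums (hG t ht).1
    · rcases Finset.mem_union.1 hs with hs | hs
      · exact Finset.mem_union_right _ (Finset.mem_image_of_mem _ hs)
      · obtain ⟨t, ht, rfl⟩ := Finset.mem_image.1 hs
        simpa using Or.inl ht
    · change s < 2 * a 4 + a 3
      rcases Finset.mem_union.1 hs with hs | hs
      · exact (hG s hs).2.2
      · obtain ⟨t, ht, rfl⟩ := Finset.mem_image.1 hs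
        have := (hG t ht).2.1
        omega
  | succ n hn ih =>
    obtain ⟨S, hmem, hneg, hlt, hcard⟩ := ih (by omega)
    have hg : a n + a (n - 1) ≤ a (n + 1) := hgrow (n + 1) (Finset.mem_Icc.2 ⟨by omega, hnN⟩)
    have hp := hpos (n - 1) (Finset.mem_Icc.2 ⟨by omega, by omega⟩)
    have hp' := hpos (n + 1) (Finset.mem_Icc.2 ⟨by omega, by omega⟩)
    have h := three_mul_card_le_card_shifts S (a (n + 1)) hneg fun s hs => by
      have := hlt s hs
      omega
    refine ⟨S.image (· + a (n + 1)) ∪ S.image (· - a (n + 1)), fun s hs => ?_, fun s hs => ?_,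
      fun s hs => ?_, ?_⟩
    · rcases Finset.mem_union.1 hs with hs | hs
      · obtain ⟨t, ht, rfl⟩ := Finset.mem_image.1 hs
        simpa using add_mul_mem_omitOneSums (hmem t ht) (Or.inr rfl)
      · obtain ⟨t, ht, rfl⟩ := Finset.mem_image.1 hs
        simpa [sub_eq_add_neg] using add_mul_mem_omitOneSums (hmem t ht) (Or.inl rfl)
    · rcases Finset.mem_union.1 hs with hs | hs
      · obtain ⟨t, ht, rfl⟩ := Finset.mem_image.1 hs
        exact Finset.mem_union_right _ (Finset.mem_image.2 ⟨-t, hneg t ht, by ring⟩)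
      · obtain ⟨t, ht, rfl⟩ := Finset.mem_image.1 hs
        exact Finset.mem_union_left _ (Finset.mem_image.2 ⟨-t, hneg t ht, by ring⟩)
    · change s < 2 * a (n + 1) + a n
      rcases Finset.mem_union.1 hs with hs | hs
      all_goals
        obtain ⟨t, ht, rfl⟩ := Finset.mem_image.1 hs
        have := hlt t ht
        omega
    · rcases hn.eq_or_lt with rfl | hn
      · omega
      · nlinarith

lemma omitOneSums_subset_signedSumset {h : ℕ} {a : ℕ → ℤ}
    (hinj : Set.InjOn a (Finset.Icc 1 (h + 1))) :
    omitOneSums a (h + 1) ⊆ signedSumset h ((Finset.Icc 1 (h + 1)).image a) := by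
  rintro s ⟨g, hg, hsum, rfl⟩
  obtain ⟨f, hf, hfA, hfa⟩ : ∃ f : ℤ → ℤ, (∀ x, f x = -1 ∨ f x = 0 ∨ f x = 1) ∧
      (∀ x ∉ (Finset.Icc 1 (h + 1)).image a, f x = 0) ∧
      ∀ i ∈ Finset.Icc 1 (h + 1), f (a i) = g i := by
    refine ⟨fun x => if x ∈ (Finset.Icc 1 (h + 1)).image a then
      g (Function.invFunOn a (Finset.Icc 1 (h + 1)) x) else 0, fun x => ?_,
      fun x hx => if_neg hx, fun i hi => ?_⟩
    · dsimp only
      split_ifs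
      · exact hg _
      · simp
    · dsimp only
      rw [if_pos (Finset.mem_image_of_mem a hi), hinj.leftInvOn_invFunOn hi]
  refine ⟨f, hf, hfA, ?_, ?_⟩
  · rw [Finset.sum_image hinj,
      Finset.sum_congr rfl (g := fun i => |g i|) fun i hi => by rw [hfa i hi]]
    push_cast at hsum
    omega
  · rw [Finset.sum_image hinj]
    exact Finset.sum_congr rfl fun i hi => by rw [hfa i hi]

lemma finite_signedSumset (h : ℕ) (A : Finset ℤ) : (signedSumset h A).Finite := by
  refine (Set.finite_Icc (-∑ x ∈ A, |x|) (∑ x ∈ A, |x|)).subset ?_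
  rintro s ⟨f, hf, -, -, rfl⟩
  rw [Set.mem_Icc, ← abs_le]
  refine (Finset.abs_sum_le_sum_abs _ _).trans (Finset.sum_le_sum fun x _ => ?_)
  rcases hf x with h | h | h <;> simp [h]

theorem stmt12 (h : ℕ) (hh : 3 ≤ h)
    (a : ℕ → ℤ) (hpos : ∀ i ∈ Finset.Icc 1 (h + 1), 0 < a i)
    (hmono : ∀ i ∈ Finset.Icc 1 (h + 1), ∀ j ∈ Finset.Icc 1 (h + 1),
      i < j → a i < a j)
    (hgrow : ∀ i ∈ Finset.Icc 4 (h + 1), a (i - 1) + a (i - 2) ≤ a i) :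
    (h + 1) ^ 2 + 1 ≤ (signedSumset h ((Finset.Icc 1 (h + 1)).image a)).ncard := by
  have hmem : ∀ i, 1 ≤ i → i ≤ h + 1 → i ∈ Finset.Icc 1 (h + 1) := fun i h1 h2 =>
    Finset.mem_Icc.2 ⟨h1, h2⟩
  have hinj : Set.InjOn a (Finset.Icc 1 (h + 1)) :=
    StrictMonoOn.injOn fun i hi j hj hij => hmono i hi j hj hij
  obtain ⟨S, hS, -, -, hcard⟩ := exists_symmetric_omitOneSums a (h + 1)
    (hpos 1 (hmem 1 (by omega) (by omega)))
    (hmono 1 (hmem 1 (by omega) (by omega)) 2 (hmem 2 (by omega) (by omega)) (by omega))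
    (hmono 2 (hmem 2 (by omega) (by omega)) 3 (hmem 3 (by omega) (by omega)) (by omega))
    hgrow hpos (h + 1) (by omega) le_rfl
  calc (h + 1) ^ 2 + 1 ≤ S.card := hcard
    _ = (S : Set ℤ).ncard := (Set.ncard_coe_finset S).symm
    _ ≤ _ := Set.ncard_le_ncard
      (fun s hs => omitOneSums_subset_signedSumset hinj (hS s hs)) (finite_signedSumset _ _)
end

section
/- Let A be a set of k ≥ 5 positive integers with |4^∧_± A| = 8k − 15. Then A = min(A)·{1, 3, 5, …, 2k−1}. -/
open Finset

namespace SignedSumset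

/-- Sign patterns on five elements with exactly one zero. -/
def IsPattern (p : ℤ × ℤ × ℤ × ℤ × ℤ) : Prop :=
  (p.1 = -1 ∨ p.1 = 0 ∨ p.1 = 1) ∧ (p.2.1 = -1 ∨ p.2.1 = 0 ∨ p.2.1 = 1) ∧
    (p.2.2.1 = -1 ∨ p.2.2.1 = 0 ∨ p.2.2.1 = 1) ∧
    (p.2.2.2.1 = -1 ∨ p.2.2.2.1 = 0 ∨ p.2.2.2.1 = 1) ∧
    (p.2.2.2.2 = -1 ∨ p.2.2.2.2 = 0 ∨ p.2.2.2.2 = 1) ∧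
    |p.1| + |p.2.1| + |p.2.2.1| + |p.2.2.2.1| + |p.2.2.2.2| = 4

instance : DecidablePred IsPattern := fun _ => by unfold IsPattern; infer_instance

/-- The signed sum of `a, b, c, d, e` with the given coefficients. -/
def signedEval (a b c d e : ℤ) (p : ℤ × ℤ × ℤ × ℤ × ℤ) : ℤ :=
  p.1 * a + p.2.1 * b + p.2.2.1 * c + p.2.2.2.1 * d + p.2.2.2.2 * e

theorem signedSumset_mono (h : ℕ) {A B : Finset ℤ} (hAB : A ⊆ B) :
    signedSumset h A ⊆ signedSumset h B := by
  rintro s ⟨f, hf, h0, hsum, rfl⟩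
  refine ⟨f, hf, fun a ha => h0 a fun h => ha (hAB h), ?_, ?_⟩
  · rw [← hsum]
    exact (Finset.sum_subset hAB fun x _ hx => by simp [h0 x hx]).symm
  · exact Finset.sum_subset hAB fun x _ hx => by simp [h0 x hx]

theorem neg_mem_signedSumset {h : ℕ} {A : Finset ℤ} {s : ℤ} (hs : s ∈ signedSumset h A) :
    -s ∈ signedSumset h A := by
  obtain ⟨f, hf, h0, hsum, rfl⟩ := hs
  refine ⟨fun a => -f a, fun a => ?_, fun a ha => by simp [h0 a ha], by simpa using hsum, by simp⟩
  rcases hf a with h | h | h <;> simp [h]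

/-- A signed sum of four elements is at most the sum of the four largest elements. -/
theorem le_of_mem_signedSumset {A : Finset ℤ} (hA : ∀ a ∈ A, 0 < a) {p q r t : ℤ}
    (hpq : p < q) (hqr : q < r) (hrt : r < t) (hq : q ∈ A) (hr : r ∈ A) (ht : t ∈ A)
    (hle : ∀ a ∈ A, a = q ∨ a = r ∨ a = t ∨ a ≤ p) {s : ℤ} (hs : s ∈ signedSumset 4 A) :
    s ≤ p + q + r + t := by
  obtain ⟨f, hf, -, hsum, rfl⟩ := hs
  have h1 : ∑ a ∈ A, f a * a ≤ ∑ a ∈ A, (|f a| * p + ((if a = q then q - p else 0) +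
      (if a = r then r - p else 0) + (if a = t then t - p else 0))) := by
    refine Finset.sum_le_sum fun a ha => ?_
    have ha0 := hA a ha
    have hc := hle a ha
    rcases hf a with h | h | h <;> rw [h] <;> simp only [abs_neg, abs_one, abs_zero] <;>
      split_ifs <;> omega
  rw [Finset.sum_add_distrib, ← Finset.sum_mul, hsum, Finset.sum_add_distrib,
    Finset.sum_add_distrib, Finset.sum_ite_eq', Finset.sum_ite_eq', Finset.sum_ite_eq',
    if_pos hq, if_pos hr, if_pos ht] at h1
  push_cast at h1
  linarith

theorem finite_signedSumset (h : ℕ) (A : Finset ℤ) : (signedSumset h A).Finite := by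
  refine (Set.finite_Icc (-∑ a ∈ A, |a|) (∑ a ∈ A, |a|)).subset ?_
  rintro s ⟨f, hf, -, -, rfl⟩
  rw [Set.mem_Icc, ← abs_le]
  refine (Finset.abs_sum_le_sum_abs _ _).trans (Finset.sum_le_sum fun a _ => ?_)
  rcases hf a with h | h | h <;> simp [h]

theorem signedEval_mem_signedSumset {A : Finset ℤ} {a b c d e : ℤ} (hab : a < b) (hbc : b < c)
    (hcd : c < d) (hde : d < e) (ha : a ∈ A) (hb : b ∈ A) (hc : c ∈ A) (hd : d ∈ A) (he : e ∈ A)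
    {p : ℤ × ℤ × ℤ × ℤ × ℤ} (hp : IsPattern p) :
    signedEval a b c d e p ∈ signedSumset 4 A := by
  obtain ⟨p, q, r, s, t⟩ := p
  obtain ⟨h1, h2, h3, h4, h5, hsum⟩ := hp
  simp only at h1 h2 h3 h4 h5 hsum
  have key : ∀ g : ℤ → ℤ → ℤ, (∀ x, g 0 x = 0) →
      ∑ x ∈ A, g (if x = a then p else if x = b then q else if x = c then r else
        if x = d then s else if x = e then t else 0) x = g p a + g q b + g r c + g s d + g t e := by
    intro g hg
    have : ∀ x ∈ A, g (if x = a then p else if x = b then q else if x = c then r else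
        if x = d then s else if x = e then t else 0) x =
        (if x = a then g p x else 0) + (if x = b then g q x else 0) +
        (if x = c then g r x else 0) + (if x = d then g s x else 0) +
        (if x = e then g t x else 0) := by
      intro x _
      split_ifs <;> first | omega | simp [hg]
    rw [Finset.sum_congr rfl this]
    simp [Finset.sum_add_distrib, ha, hb, hc, hd, he]
  refine ⟨fun x => if x = a then p else if x = b then q else if x = c then r else
        if x = d then s else if x = e then t else 0, fun x => ?_, fun x hx => ?_, ?_, ?_⟩
  · dsimp only
    split_ifs <;> first | assumption | simp
  · have : x ≠ a ∧ x ≠ b ∧ x ≠ c ∧ x ≠ d ∧ x ≠ e := by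
      refine ⟨?_, ?_, ?_, ?_, ?_⟩ <;> rintro rfl <;> contradiction
    simp [this]
  · exact (key (fun y _ => |y|) (by simp)).trans (by exact_mod_cast hsum)
  · exact (key (fun y x => y * x) (by simp)).symm

theorem ncard_add_length_le {S T : Set ℤ} (hT : T.Finite) (hST : S ⊆ T) (l : List ℤ)
    (hl : l.Nodup) (hlT : ∀ x ∈ l, x ∈ T) (hlS : ∀ x ∈ l, x ∉ S) :
    S.ncard + l.length ≤ T.ncard := by
  rw [← List.toFinset_card_of_nodup hl, ← Set.ncard_coe_finset, ← Set.ncard_union_eq ?_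
    (hT.subset hST) (Finset.finite_toSet _)]
  · exact Set.ncard_le_ncard (Set.union_subset hST fun x hx => hlT x (by simpa using hx)) hT
  · rw [Set.disjoint_left]
    intro x hx hx'
    exact hlS x (by simpa using hx') hx

/-- Positive elements of a finite symmetric set come in pairs `x, -x`, so they count twice. -/
theorem ncard_add_two_mul_length_le {S T : Set ℤ} (hT : T.Finite) (hST : S ⊆ T)
    (hSneg : ∀ x ∈ S, -x ∈ S) (hTneg : ∀ x ∈ T, -x ∈ T) (l : List ℤ)
    (hl : (0 :: l).Pairwise (· < ·)) (hlT : ∀ x ∈ l, x ∈ T) (hlS : ∀ x ∈ l, x ∉ S) :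
    S.ncard + 2 * l.length ≤ T.ncard := by
  rw [List.pairwise_cons] at hl
  have hnd : l.Nodup := hl.2.imp fun h => h.ne
  have := ncard_add_length_le hT hST (l ++ l.map (- ·)) ?_ ?_ ?_
  · simpa [two_mul] using this
  · refine List.Nodup.append hnd (hnd.map neg_injective) fun x hx hx' => ?_
    obtain ⟨y, hy, rfl⟩ := List.mem_map.1 hx'
    have h1 := hl.1 _ hx
    have h2 := hl.1 _ hy
    omega
  · intro x hx
    rcases List.mem_append.1 hx with hx | hx
    · exact hlT x hx
    · obtain ⟨y, hy, rfl⟩ := List.mem_map.1 hx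
      exact hTneg y (hlT y hy)
  · intro x hx
    rcases List.mem_append.1 hx with hx | hx
    · exact hlS x hx
    · obtain ⟨y, hy, rfl⟩ := List.mem_map.1 hx
      exact fun h => hlS y hy (by simpa using hSneg _ h)

theorem ncard_signedSumset_or_progression {A : Finset ℤ} {a b c d e : ℤ} (h0 : 0 < a) (hab : a < b)
    (hbc : b < c) (hcd : c < d) (hde : d < e) (ha : a ∈ A) (hb : b ∈ A) (hc : c ∈ A) (hd : d ∈ A)
    (he : e ∈ A) :
    26 ≤ (signedSumset 4 A).ncard ∨ (b = 3 * a ∧ c = 5 * a ∧ d = 7 * a ∧ e = 9 * a) := by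
  have hcount : ∀ l : List (ℤ × ℤ × ℤ × ℤ × ℤ), (∀ p ∈ l, IsPattern p) →
      (0 :: l.map (signedEval a b c d e)).IsChain (· < ·) → l.length = 13 →
      26 ≤ (signedSumset 4 A).ncard := by
    intro l hl hchain hlen
    have := ncard_add_two_mul_length_le (finite_signedSumset 4 A) (Set.empty_subset _)
      (by simp) (fun _ => neg_mem_signedSumset) _ hchain.pairwise (fun x hx => by
        obtain ⟨p, hp, rfl⟩ := List.mem_map.1 hx
        exact signedEval_mem_signedSumset hab hbc hcd hde ha hb hc hd he (hl p hp)) (by simp)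
    simp only [Set.ncard_empty, List.length_map, hlen] at this
    omega
  rcases lt_trichotomy (a + d) (b + c) with h | h | h
  · rcases lt_trichotomy (2 * a + c) (d) with h | h | h
    · refine Or.inl (hcount
         [(-1, 1, 1, -1, 0), (1, 1, 1, -1, 0), (-1, 1, 0, -1, 1), (1, 1, 0, -1, 1),
          (-1, 1, -1, 0, 1), (1, 1, -1, 0, 1), (-1, 0, -1, 1, 1), (-1, -1, 0, 1, 1),
          (1, -1, 0, 1, 1), (-1, 1, 1, 0, 1), (1, 1, 1, 0, 1), (-1, 1, 0, 1, 1),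
          (-1, 0, 1, 1, 1)]
        (by decide) ?_ rfl)
      simp [signedEval]; and_intros <;> omega
    · refine Or.inl (hcount
         [(-1, 1, 1, -1, 0), (1, 1, 1, -1, 0), (-1, 1, 0, -1, 1), (-1, 0, 1, -1, 1),
          (1, 0, 1, -1, 1), (-1, -1, 1, 0, 1), (-1, -1, 0, 1, 1), (1, -1, 0, 1, 1),
          (-1, 1, 1, 0, 1), (-1, 1, 0, 1, 1), (-1, 0, 1, 1, 1), (1, 0, 1, 1, 1),
          (0, 1, 1, 1, 1)]
        (by decide) ?_ rfl)
      simp [signedEval]; and_intros <;> omega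
    · refine Or.inl (hcount
         [(-1, 1, 1, -1, 0), (-1, 1, 0, -1, 1), (-1, 1, -1, 0, 1), (1, 1, 0, -1, 1),
          (1, 0, 1, -1, 1), (1, -1, 1, 0, 1), (1, -1, 0, 1, 1), (-1, 1, 1, 0, 1),
          (-1, 1, 0, 1, 1), (1, 1, 1, 0, 1), (1, 1, 0, 1, 1), (1, 0, 1, 1, 1),
          (0, 1, 1, 1, 1)]
        (by decide) ?_ rfl)
      simp [signedEval]; and_intros <;> omega
  · rcases lt_trichotomy (c + e) (2 * d) with h | h | h
    · refine Or.inl (hcount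
         [(-1, 1, 0, 1, -1), (-1, 1, 0, -1, 1), (-1, 1, -1, 1, 0), (-1, 1, -1, 0, 1),
          (0, -1, -1, 1, 1), (-1, -1, 1, 0, 1), (-1, -1, 0, 1, 1), (1, -1, 0, 1, 1),
          (-1, 1, 1, 1, 0), (-1, 1, 1, 0, 1), (0, -1, 1, 1, 1), (-1, 0, 1, 1, 1),
          (1, 0, 1, 1, 1)]
        (by decide) ?_ rfl)
      simp [signedEval]; and_intros <;> omega
    · rcases lt_trichotomy (b + 2 * e) (2 * c + d) with h | h | h
      · refine Or.inl (hcount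
           [(1, -1, -1, 0, 1), (-1, 1, 0, -1, 1), (0, -1, 1, 1, -1), (-1, 0, 1, 1, -1),
            (0, -1, 1, -1, 1), (-1, 0, 1, -1, 1), (0, -1, -1, 1, 1), (-1, 0, -1, 1, 1),
            (1, 0, -1, 1, 1), (0, 1, -1, 1, 1), (1, -1, 1, 1, 0), (1, -1, 1, 0, 1),
            (1, -1, 0, 1, 1)]
          (by decide) ?_ rfl)
        simp [signedEval]; and_intros <;> omega
      · refine Or.inl (hcount
           [(1, -1, -1, 0, 1), (0, -1, 1, 1, -1), (-1, 0, 1, 1, -1), (0, -1, 1, -1, 1),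
            (-1, 0, 1, -1, 1), (0, -1, -1, 1, 1), (-1, 0, -1, 1, 1), (-1, -1, 1, 1, 0),
            (-1, -1, 1, 0, 1), (-1, -1, 0, 1, 1), (1, -1, 0, 1, 1), (-1, 1, 1, 0, 1),
            (-1, 1, 0, 1, 1)]
          (by decide) ?_ rfl)
        simp [signedEval]; and_intros <;> omega
      · rcases lt_trichotomy (b + e) (2 * c) with h | h | h
        · refine Or.inl (hcount
             [(1, -1, -1, 0, 1), (0, -1, 1, 1, -1), (-1, 1, 0, -1, 1), (-1, 0, 1, 1, -1),
              (-1, 1, -1, 0, 1), (0, -1, 1, -1, 1), (-1, 0, 1, -1, 1), (0, -1, -1, 1, 1),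
              (-1, 0, -1, 1, 1), (-1, -1, 1, 1, 0), (1, -1, 1, 1, 0), (0, 1, -1, 1, 1),
              (1, -1, 1, 0, 1)]
            (by decide) ?_ rfl)
          simp [signedEval]; and_intros <;> omega
        · refine Or.inl (hcount
             [(0, -1, 1, 1, -1), (-1, 0, 1, 1, -1), (0, -1, 1, -1, 1), (-1, 0, 1, -1, 1),
              (0, -1, -1, 1, 1), (-1, 0, -1, 1, 1), (-1, -1, 1, 0, 1), (-1, -1, 0, 1, 1),
              (1, -1, 0, 1, 1), (-1, 1, 1, 0, 1), (-1, 1, 0, 1, 1), (0, -1, 1, 1, 1),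
              (-1, 0, 1, 1, 1)]
            (by decide) ?_ rfl)
          simp [signedEval]; and_intros <;> omega
        · rcases lt_trichotomy (b + d) (2 * c) with h | h | h
          · refine Or.inl (hcount
               [(0, -1, 1, 1, -1), (1, -1, -1, 0, 1), (-1, 0, 1, 1, -1), (-1, 1, 0, -1, 1),
                (0, -1, 1, -1, 1), (-1, 1, -1, 0, 1), (-1, 0, 1, -1, 1), (0, -1, -1, 1, 1),
                (-1, -1, 1, 1, 0), (-1, 0, -1, 1, 1), (-1, -1, 1, 0, 1), (1, -1, 1, 0, 1),
                (0, 1, -1, 1, 1)]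
              (by decide) ?_ rfl)
            simp [signedEval]; and_intros <;> omega
          · rcases lt_trichotomy (2 * b + c + d) (2 * e) with h | h | h
            · refine Or.inl (hcount
                 [(-1, -1, -1, 0, 1), (-1, 0, 1, 1, -1), (1, 0, 1, 1, -1), (0, -1, 1, -1, 1),
                  (0, 1, 1, 1, -1), (-1, 0, 1, -1, 1), (1, 0, 1, -1, 1), (0, -1, -1, 1, 1),
                  (0, 1, 1, -1, 1), (-1, 0, -1, 1, 1), (1, 0, -1, 1, 1), (-1, -1, 0, 1, 1),
                  (0, 1, -1, 1, 1)]
                (by decide) ?_ rfl)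
              simp [signedEval]; and_intros <;> omega
            · exact Or.inr (by omega)
            · refine Or.inl (hcount
                 [(-1, 0, 1, 1, -1), (0, -1, 1, -1, 1), (1, 0, 1, 1, -1), (0, 1, 1, 1, -1),
                  (1, 0, 1, -1, 1), (0, 1, 1, -1, 1), (1, 0, -1, 1, 1), (0, 1, -1, 1, 1),
                  (-1, 1, 1, 0, 1), (0, -1, 1, 1, 1), (-1, 0, 1, 1, 1), (1, 1, 0, 1, 1),
                  (1, 0, 1, 1, 1)]
                (by decide) ?_ rfl)
              simp [signedEval]; and_intros <;> omega
          · refine Or.inl (hcount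
               [(0, 1, -1, -1, 1), (1, -1, -1, 0, 1), (0, -1, 1, -1, 1), (-1, 1, 0, -1, 1),
                (-1, 0, 1, -1, 1), (-1, 1, -1, 0, 1), (0, -1, -1, 1, 1), (-1, -1, 1, 0, 1),
                (-1, 0, -1, 1, 1), (-1, -1, 0, 1, 1), (1, -1, 0, 1, 1), (0, 1, -1, 1, 1),
                (-1, 1, 1, 0, 1)]
              (by decide) ?_ rfl)
            simp [signedEval]; and_intros <;> omega
    · refine Or.inl (hcount
         [(1, -1, 0, -1, 1), (1, -1, -1, 0, 1), (0, -1, 1, -1, 1), (-1, 0, 1, -1, 1),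
          (0, -1, -1, 1, 1), (-1, 0, -1, 1, 1), (1, 0, -1, 1, 1), (0, 1, -1, 1, 1),
          (-1, 1, 1, 0, 1), (0, -1, 1, 1, 1), (-1, 0, 1, 1, 1), (1, 0, 1, 1, 1),
          (0, 1, 1, 1, 1)]
        (by decide) ?_ rfl)
      simp [signedEval]; and_intros <;> omega
  · rcases lt_trichotomy (a + 2 * b) (d) with h | h | h
    · rcases lt_trichotomy (b + 2 * d) (2 * c + e) with h | h | h
      · refine Or.inl (hcount
           [(1, -1, -1, 1, 0), (0, -1, 1, -1, 1), (-1, 0, 1, -1, 1), (1, 0, 1, -1, 1),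
            (0, 1, 1, -1, 1), (-1, -1, 1, 0, 1), (1, -1, 1, 0, 1), (-1, 1, 1, 0, 1),
            (1, 1, 1, 0, 1), (0, -1, 1, 1, 1), (-1, 0, 1, 1, 1), (1, 0, 1, 1, 1),
            (0, 1, 1, 1, 1)]
          (by decide) ?_ rfl)
        simp [signedEval]; and_intros <;> omega
      · refine Or.inl (hcount
           [(1, -1, -1, 1, 0), (0, -1, 1, -1, 1), (-1, 0, 1, -1, 1), (-1, 1, -1, 0, 1),
            (1, 1, -1, 0, 1), (0, -1, -1, 1, 1), (-1, 0, -1, 1, 1), (1, 0, -1, 1, 1),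
            (0, 1, -1, 1, 1), (-1, 1, 0, 1, 1), (-1, 0, 1, 1, 1), (1, 0, 1, 1, 1),
            (0, 1, 1, 1, 1)]
          (by decide) ?_ rfl)
        simp [signedEval]; and_intros <;> omega
      · refine Or.inl (hcount
           [(0, -1, 1, -1, 1), (-1, 0, 1, -1, 1), (-1, 1, -1, 1, 0), (-1, 1, -1, 0, 1),
            (1, 1, -1, 0, 1), (0, -1, -1, 1, 1), (-1, 0, -1, 1, 1), (1, 0, -1, 1, 1),
            (0, 1, -1, 1, 1), (0, -1, 1, 1, 1), (-1, 0, 1, 1, 1), (1, 0, 1, 1, 1),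
            (0, 1, 1, 1, 1)]
          (by decide) ?_ rfl)
        simp [signedEval]; and_intros <;> omega
    · refine Or.inl (hcount
         [(1, 1, 1, -1, 0), (0, -1, 1, -1, 1), (-1, 0, 1, -1, 1), (1, 1, 0, -1, 1),
          (1, 0, 1, -1, 1), (0, 1, 1, -1, 1), (-1, -1, 0, 1, 1), (1, 0, -1, 1, 1),
          (0, 1, -1, 1, 1), (-1, 1, 0, 1, 1), (-1, 0, 1, 1, 1), (1, 1, 0, 1, 1),
          (1, 0, 1, 1, 1)]
        (by decide) ?_ rfl)
      simp [signedEval]; and_intros <;> omega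
    · refine Or.inl (hcount
         [(1, -1, -1, 1, 0), (1, -1, -1, 0, 1), (-1, 1, -1, 0, 1), (0, -1, -1, 1, 1),
          (-1, 0, -1, 1, 1), (-1, -1, 0, 1, 1), (1, 0, -1, 1, 1), (0, 1, -1, 1, 1),
          (-1, 1, 0, 1, 1), (-1, 0, 1, 1, 1), (1, 1, 0, 1, 1), (1, 0, 1, 1, 1),
          (0, 1, 1, 1, 1)]
        (by decide) ?_ rfl)
      simp [signedEval]; and_intros <;> omega

theorem le_ncard_signedSumset_progression {A : Finset ℤ} {a : ℤ} (h0 : 0 < a) (h1 : a ∈ A)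
    (h3 : 3 * a ∈ A) (h5 : 5 * a ∈ A) (h7 : 7 * a ∈ A) (h9 : 9 * a ∈ A) :
    25 ≤ (signedSumset 4 A).ncard := by
  have hmem : ∀ p, IsPattern p →
      signedEval a (3 * a) (5 * a) (7 * a) (9 * a) p ∈ signedSumset 4 A := fun p hp =>
    signedEval_mem_signedSumset (by omega) (by omega) (by omega) (by omega) h1 h3 h5 h7 h9 hp
  have hz : (0 : ℤ) ∈ signedSumset 4 A := by
    have := hmem (1, -1, 0, -1, 1) (by decide)
    convert this using 1
    simp [signedEval]; ring
  have := ncard_add_two_mul_length_le (S := {0}) (finite_signedSumset 4 A)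
    (Set.singleton_subset_iff.2 hz) (by simp) (fun _ => neg_mem_signedSumset)
    (([(-1, 0, 1, 1, -1), (0, -1, 1, -1, 1), (0, 1, 1, 1, -1), (0, -1, -1, 1, 1),
      (0, 1, 1, -1, 1), (1, 0, -1, 1, 1), (0, 1, -1, 1, 1), (-1, 1, 1, 0, 1),
      (0, -1, 1, 1, 1), (-1, 0, 1, 1, 1), (1, 0, 1, 1, 1), (0, 1, 1, 1, 1)] : List _).map
      (signedEval a (3 * a) (5 * a) (7 * a) (9 * a))) ?_ ?_ ?_
  · simpa using this
  · refine List.IsChain.pairwise ?_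
    simp [signedEval]; and_intros <;> omega
  · intro x hx
    obtain ⟨p, hp, rfl⟩ := List.mem_map.1 hx
    refine hmem p ?_
    clear hx; revert p; decide
  · intro x hx
    simp [signedEval] at hx
    rw [Set.mem_singleton_iff]
    omega

theorem two_mul_dvd_of_mem_signedSumset {A : Finset ℤ} {m : ℤ}
    (hA : ∀ a ∈ A, ∃ i : ℤ, a = m * (2 * i + 1)) {s : ℤ} (hs : s ∈ signedSumset 4 A) :
    2 * m ∣ s := by
  obtain ⟨f, hf, -, hsum, rfl⟩ := hs
  have h1 : 2 * m ∣ ∑ a ∈ A, (f a * a - m * |f a|) := by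
    refine Finset.dvd_sum fun a ha => ?_
    obtain ⟨i, hi⟩ := hA a ha
    rcases hf a with h | h | h <;> rw [h, hi]
    · exact ⟨-i - 1, by norm_num; ring⟩
    · simp
    · exact ⟨i, by norm_num; ring⟩
  rw [Finset.sum_sub_distrib, ← Finset.mul_sum, hsum] at h1
  have h2 : 2 * m ∣ m * ((4 : ℕ) : ℤ) := ⟨2, by push_cast; ring⟩
  exact (dvd_sub_left h2).1 h1

theorem ncard_signedSumset_image (a : ℕ → ℤ) (n : ℕ) (h0 : 0 < a 0)
    (ha : ∀ i j, i < j → j < n → a i < a j) (j : ℕ) (hj : j + 5 ≤ n) :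
    8 * j + 25 ≤ (signedSumset 4 ((range (j + 5)).image a)).ncard ∧
      ((signedSumset 4 ((range (j + 5)).image a)).ncard = 8 * j + 25 →
        ∀ i < j + 5, a i = a 0 * (2 * (i : ℤ) + 1)) := by
  induction j with
  | zero =>
    have h01 := ha 0 1 (by omega) (by omega)
    have h12 := ha 1 2 (by omega) (by omega)
    have h23 := ha 2 3 (by omega) (by omega)
    have h34 := ha 3 4 (by omega) (by omega)
    have hm : ∀ i < 5, a i ∈ (range (0 + 5)).image a := fun i hi =>
      mem_image_of_mem a (by simpa using hi)
    rcases ncard_signedSumset_or_progression h0 h01 h12 h23 h34 (hm 0 (by omega))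
      (hm 1 (by omega)) (hm 2 (by omega)) (hm 3 (by omega)) (hm 4 (by omega)) with h | h
    · omega
    · obtain ⟨e1, e2, e3, e4⟩ := h
      refine ⟨le_ncard_signedSumset_progression h0 (hm 0 (by omega)) (e1 ▸ hm 1 (by omega))
        (e2 ▸ hm 2 (by omega)) (e3 ▸ hm 3 (by omega)) (e4 ▸ hm 4 (by omega)), fun _ i hi => ?_⟩
      interval_cases i <;> push_cast <;> omega
  | succ j ih =>
    obtain ⟨ihle, iheq⟩ := ih (by omega)
    set A := (range (j + 5)).image a with hA
    set B := (range (j + 1 + 5)).image a with hB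
    have hAB : A ⊆ B := image_subset_image (range_subset_range.2 (by omega))
    have hmA : ∀ i < j + 5, a i ∈ A := fun i hi => mem_image_of_mem a (by simpa using hi)
    have hmB : ∀ i < j + 6, a i ∈ B := fun i hi => mem_image_of_mem a (by simpa using hi)
    have hmono : ∀ i i', i ≤ i' → i' < n → a i ≤ a i' := by
      intro i i' h h'
      rcases h.eq_or_lt with rfl | h
      · rfl
      · exact (ha i i' h h').le
    have hA0 : ∀ x ∈ A, 0 < x := by
      intro x hx
      obtain ⟨i, hi, rfl⟩ := mem_image.1 hx
      rw [mem_range] at hi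
      exact h0.trans_le (hmono 0 i (by omega) (by omega))
    have g0 : 0 < a j := h0.trans_le (hmono 0 j (by omega) (by omega))
    have g1 := ha j (j + 1) (by omega) (by omega)
    have g2 := ha (j + 1) (j + 2) (by omega) (by omega)
    have g3 := ha (j + 2) (j + 3) (by omega) (by omega)
    have g4 := ha (j + 3) (j + 4) (by omega) (by omega)
    have g5 := ha (j + 4) (j + 5) (by omega) (by omega)
    have hmax : ∀ s ∈ signedSumset 4 A, s ≤ a (j + 1) + a (j + 2) + a (j + 3) + a (j + 4) := by
      intro s hs
      refine le_of_mem_signedSumset hA0 g2 g3 g4 (hmA _ (by omega)) (hmA _ (by omega))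
        (hmA _ (by omega)) (fun x hx => ?_) hs
      obtain ⟨i, hi, rfl⟩ := mem_image.1 hx
      rw [mem_range] at hi
      by_cases h : i ≤ j + 1
      · exact Or.inr (Or.inr (Or.inr (hmono i (j + 1) h (by omega))))
      · obtain rfl | rfl | rfl : i = j + 2 ∨ i = j + 3 ∨ i = j + 4 := by omega
        all_goals simp
    have hmem : ∀ p, IsPattern p → signedEval (a (j + 1)) (a (j + 2)) (a (j + 3)) (a (j + 4))
        (a (j + 5)) p ∈ signedSumset 4 B := fun p hp =>
      signedEval_mem_signedSumset g2 g3 g4 g5 (hmB _ (by omega)) (hmB _ (by omega))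
        (hmB _ (by omega)) (hmB _ (by omega)) (hmB _ (by omega)) hp
    have hmem' : ∀ p, IsPattern p → signedEval (a j) (a (j + 1)) (a (j + 3)) (a (j + 4))
        (a (j + 5)) p ∈ signedSumset 4 B := fun p hp =>
      signedEval_mem_signedSumset g1 (g2.trans g3) g4 g5 (hmB _ (by omega)) (hmB _ (by omega))
        (hmB _ (by omega)) (hmB _ (by omega)) (hmB _ (by omega)) hp
    have hnew : ∀ x ∈ [(1, 1, 1, 0, 1), (1, 1, 0, 1, 1), (1, 0, 1, 1, 1), (0, 1, 1, 1, 1)].map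
        (signedEval (a (j + 1)) (a (j + 2)) (a (j + 3)) (a (j + 4)) (a (j + 5))),
        x ∈ signedSumset 4 B ∧ x ∉ signedSumset 4 A := by
      intro x hx
      obtain ⟨p, hp, rfl⟩ := List.mem_map.1 hx
      refine ⟨hmem p (by clear hx; revert p; decide), fun h => ?_⟩
      have := hmax _ h
      simp only [List.mem_cons, List.not_mem_nil, or_false] at hp
      obtain rfl | rfl | rfl | rfl := hp <;> simp [signedEval] at this <;> omega
    have hadd := ncard_add_two_mul_length_le (finite_signedSumset 4 B) (signedSumset_mono 4 hAB)
      (fun _ => neg_mem_signedSumset) (fun _ => neg_mem_signedSumset) _ (List.IsChain.pairwise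
        (by simp [signedEval]; and_intros <;> omega)) (fun x hx => (hnew x hx).1)
      (fun x hx => (hnew x hx).2)
    simp only [List.length_map, List.length_cons, List.length_nil] at hadd
    refine ⟨by omega, fun hcard => ?_⟩
    have hap := iheq (by omega)
    have hx : a j + a (j + 1) + a (j + 4) + a (j + 5) ∈ signedSumset 4 A := by
      by_contra hx
      have hxB : a j + a (j + 1) + a (j + 4) + a (j + 5) ∈ signedSumset 4 B := by
        simpa [signedEval] using hmem' (1, 1, 0, 1, 1) (by decide)
      have e0 := hap j (by omega)
      have e1 := hap (j + 1) (by omega)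
      have e2 := hap (j + 2) (by omega)
      have e3 := hap (j + 3) (by omega)
      have e4 := hap (j + 4) (by omega)
      have := ncard_add_two_mul_length_le (finite_signedSumset 4 B) (signedSumset_mono 4 hAB)
        (fun _ => neg_mem_signedSumset) (fun _ => neg_mem_signedSumset)
        ((a j + a (j + 1) + a (j + 4) + a (j + 5)) ::
          [(1, 1, 1, 0, 1), (1, 1, 0, 1, 1), (1, 0, 1, 1, 1), (0, 1, 1, 1, 1)].map
          (signedEval (a (j + 1)) (a (j + 2)) (a (j + 3)) (a (j + 4)) (a (j + 5))))
        (List.IsChain.pairwise ?_) (List.forall_mem_cons.2 ⟨hxB, fun x hx => (hnew x hx).1⟩)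
        (List.forall_mem_cons.2 ⟨hx, fun x hx => (hnew x hx).2⟩)
      · simp only [List.length_map, List.length_cons, List.length_nil] at this
        omega
      · have : a j + a (j + 4) < a (j + 2) + a (j + 3) := by
          rw [e0, e2, e3, e4]; push_cast; nlinarith
        simp [signedEval]; and_intros <;> omega
    have hle := hmax _ hx
    obtain ⟨y, hy⟩ := two_mul_dvd_of_mem_signedSumset (m := a 0) (fun x hx => by
      obtain ⟨i, hi, rfl⟩ := mem_image.1 hx
      exact ⟨i, hap i (mem_range.1 hi)⟩) hx
    have hlast : a (j + 5) = a 0 * (2 * ((j + 5 : ℕ) : ℤ) + 1) := by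
      have e0 := hap j (by omega)
      have e1 := hap (j + 1) (by omega)
      have e2 := hap (j + 2) (by omega)
      have e3 := hap (j + 3) (by omega)
      have e4 := hap (j + 4) (by omega)
      rw [e1, e2, e3, e4, e0] at hle
      rw [e1, e4, e0] at hy
      rw [e4] at g5
      push_cast at *
      have he : a (j + 5) = a 0 * (2 * y - 6 * j - 13) := by linarith
      rw [he] at g5 hle ⊢
      have k1 : (2 * ((j : ℤ) + 4) + 1) < 2 * y - 6 * j - 13 := lt_of_mul_lt_mul_left g5 h0.le
      have k2 : 2 * y - 6 * j - 13 ≤ 2 * (j : ℤ) + 11 := by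
        refine le_of_mul_le_mul_left ?_ h0
        linarith
      congr 1
      omega
    intro i hi
    rcases (show i < j + 5 ∨ i = j + 5 by omega) with h | rfl
    · exact hap i h
    · exact hlast

end SignedSumset

theorem stmt15 (k : ℕ) (hk : 5 ≤ k) (A : Finset ℤ)
    (hcard : A.card = k) (hpos : ∀ a ∈ A, 0 < a) (hne : A.Nonempty)
    (heq : (signedSumset 4 A).ncard = 8 * k - 15) :
    A = (Finset.Icc 1 k).image (fun i : ℕ => A.min' hne * (2 * (i : ℤ) - 1)) := by
  let a : ℕ → ℤ := fun i => if h : i < k then A.orderEmbOfFin hcard ⟨i, h⟩ else 0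
  have ha : ∀ i (h : i < k), a i = A.orderEmbOfFin hcard ⟨i, h⟩ := fun i h => dif_pos h
  have hAa : A = (range k).image a := by
    ext x
    rw [mem_image]
    constructor
    · intro hx
      have : x ∈ Set.range (A.orderEmbOfFin hcard) := by rwa [range_orderEmbOfFin]
      obtain ⟨i, rfl⟩ := this
      exact ⟨i, mem_range.2 i.2, ha i i.2⟩
    · rintro ⟨i, hi, rfl⟩
      rw [ha i (mem_range.1 hi)]
      exact orderEmbOfFin_mem A hcard _
  have hmin : a 0 = A.min' hne := (ha 0 (by omega)).trans (orderEmbOfFin_zero hcard (by omega))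
  have hmono : ∀ i j, i < j → j < k → a i < a j := by
    intro i j hij hj
    rw [ha i (hij.trans hj), ha j hj]
    exact (A.orderEmbOfFin hcard).strictMono hij
  obtain ⟨j, rfl⟩ : ∃ j, k = j + 5 := ⟨k - 5, by omega⟩
  have hap := (SignedSumset.ncard_signedSumset_image a (j + 5)
    (hmin ▸ hpos _ (A.min'_mem hne)) hmono j le_rfl).2 (by rw [← hAa]; omega)
  rw [← hmin]
  refine hAa.trans ?_
  ext x
  simp only [mem_image, mem_range, mem_Icc]
  constructor
  · rintro ⟨i, hi, rfl⟩
    exact ⟨i + 1, by omega, by rw [hap i hi]; push_cast; ring⟩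
  · rintro ⟨i, hi, rfl⟩
    exact ⟨i - 1, by omega, by rw [hap _ (by omega), Nat.cast_sub hi.1]; push_cast; ring⟩
end
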